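/- arXiv:1703.10498 — 2 statements merged into one kernel-verified Lean document; each statement's English description precedes it below -/
import Mathlib

section
/- Let M be a countable homogeneous structure with the strong small index property and locally finite algebraicity, and G = Aut(M). Then PS(M) equals the set of all H ∈ SS(M) for which there is no H' ∈ SS(M) with H' ⊊ H, H' normal in H, and [H : H'] finite. -/
open FirstOrder Cardinal

namespace PaperSSIP

variable {L : FirstOrder.Language} {M : Type*} [L.Structure M]

instance autGroup : Group (M ≃[L] M) where
  mul f g := f.comp g
  one := FirstOrder.Language.Equiv.refl L M
  inv := FirstOrder.Language.Equiv.symm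
  mul_assoc f g h := by ext x; rfl
  one_mul f := by ext x; rfl
  mul_one f := by ext x; rfl
  inv_mul_cancel f := by
    ext x
    exact f.symm_apply_apply x

theorem mul_apply (f g : M ≃[L] M) (x : M) : (f * g) x = f (g x) := rfl

theorem one_apply (x : M) : (1 : M ≃[L] M) x = x := rfl

theorem inv_apply (f : M ≃[L] M) (x : M) : f⁻¹ x = f.symm x := rfl

/-- The pointwise stabilizer of a set. -/
def ptStab (L : FirstOrder.Language) {M : Type*} [L.Structure M] (A : Set M) :
    Subgroup (M ≃[L] M) where
  carrier := {g | ∀ a ∈ A, g a = a}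
  one_mem' := fun a _ => rfl
  mul_mem' := by
    intro f g hf hg a ha
    rw [mul_apply, hg a ha, hf a ha]
  inv_mem' := by
    intro f hf a ha
    rw [inv_apply]
    conv_lhs => rw [← hf a ha]
    exact f.symm_apply_apply a

/-- The setwise stabilizer of a set. -/
def setStab (L : FirstOrder.Language) {M : Type*} [L.Structure M] (A : Set M) :
    Subgroup (M ≃[L] M) where
  carrier := {g | g '' A = A}
  one_mem' := by
    have : ⇑(1 : M ≃[L] M) = id := funext fun x => rfl
    simp only [Set.mem_setOf_eq, this, Set.image_id]
  mul_mem' := by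
    intro f g hf hg
    have : ⇑(f * g) = ⇑f ∘ ⇑g := rfl
    simp only [Set.mem_setOf_eq] at *
    rw [this, Set.image_comp, hg, hf]
  inv_mem' := by
    intro f hf
    have h1 : ⇑f⁻¹ ∘ ⇑f = id := funext fun x => f.symm_apply_apply x
    simp only [Set.mem_setOf_eq] at *
    calc ⇑f⁻¹ '' A = ⇑f⁻¹ '' (⇑f '' A) := by rw [hf]
    _ = A := by rw [← Set.image_comp, h1, Set.image_id]

/-- The orbit of a point under a subgroup of the automorphism group. -/
def orbit (H : Subgroup (M ≃[L] M)) (a : M) : Set M := {b | ∃ g ∈ H, g a = b}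

/-- The algebraic closure of a set: points with finite orbit under the pointwise
stabilizer of the set. -/
def acl (L : FirstOrder.Language) {M : Type*} [L.Structure M] (A : Set M) : Set M :=
  {a | (orbit (ptStab L A) a).Finite}

/-- A subgroup has small index if its index is less than the continuum. -/
def SmallIndex (H : Subgroup (M ≃[L] M)) : Prop := #((M ≃[L] M) ⧸ H) < continuum

/-- The strong small index property. -/
def HasSSIP (L : FirstOrder.Language) (M : Type*) [L.Structure M] : Prop :=
  ∀ H : Subgroup (M ≃[L] M), SmallIndex H →
    ∃ A : Set M, A.Finite ∧ ptStab L A ≤ H ∧ H ≤ setStab L A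

/-- Locally finite algebraicity. -/
def LocFinAlg (L : FirstOrder.Language) (M : Type*) [L.Structure M] : Prop :=
  ∀ A : Set M, A.Finite → (acl L A).Finite

/-- Membership in `𝐀(M)`: being (the substructure carried by) the algebraic closure
of a finite set. -/
def memA (L : FirstOrder.Language) {M : Type*} [L.Structure M]
    (S : L.Substructure M) : Prop :=
  ∃ B : Set M, B.Finite ∧ (S : Set M) = acl L B

/-- `G_(K, L')`: automorphisms of `M` whose restriction to `K` lies in `L'`. -/
def stabIn (S : L.Substructure M) (L' : Subgroup (↥S ≃[L] ↥S)) :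
    Subgroup (M ≃[L] M) where
  carrier := {f | ∃ e ∈ L', ∀ x : S, f (x : M) = (e x : M)}
  one_mem' := ⟨1, L'.one_mem, fun _ => rfl⟩
  mul_mem' := by
    rintro f g ⟨ef, hef, hf⟩ ⟨eg, heg, hg⟩
    refine ⟨ef * eg, mul_mem hef heg, fun x => ?_⟩
    rw [mul_apply, hg x]
    exact hf (eg x)
  inv_mem' := by
    rintro f ⟨e, he, hfe⟩
    refine ⟨e⁻¹, inv_mem he, fun x => ?_⟩
    have h1 : f ((e⁻¹ x : S) : M) = (x : M) := by
      rw [hfe (e⁻¹ x)]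
      exact congrArg _ (e.apply_symm_apply x)
    have h2 : f (f⁻¹ (x : M)) = (x : M) := f.apply_symm_apply x
    exact EquivLike.injective f (h2.trans h1.symm)

/-- The family `𝒮𝒮(M)` of subgroups of the form `G_(K, L')`. -/
def SS (L : FirstOrder.Language) (M : Type*) [L.Structure M] :
    Set (Subgroup (M ≃[L] M)) :=
  {H | ∃ (S : L.Substructure M) (L' : Subgroup (↥S ≃[L] ↥S)), memA L S ∧ H = stabIn S L'}

/-- The family `𝒫𝒮(M)` of pointwise stabilizers of members of `𝐀(M)`. -/
def PS (L : FirstOrder.Language) (M : Type*) [L.Structure M] :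
    Set (Subgroup (M ≃[L] M)) :=
  {H | ∃ S : L.Substructure M, memA L S ∧ H = ptStab L (S : Set M)}


/-- The natural action of the automorphism group on the structure. -/
instance autMulAction : MulAction (M ≃[L] M) M where
  smul f x := f x
  one_smul _ := rfl
  mul_smul _ _ _ := rfl

theorem relIndex_ptStab_singleton_ne_zero_iff (H : Subgroup (M ≃[L] M)) (a : M) :
    (ptStab L {a}).relIndex H ≠ 0 ↔ (orbit H a).Finite := by
  have hstab : (ptStab L {a}).subgroupOf H = MulAction.stabilizer H a := by
    ext g
    change (∀ b ∈ ({a} : Set M), (g : M ≃[L] M) b = b) ↔ (g : M ≃[L] M) a = a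
    simp
  have horb : orbit H a = MulAction.orbit H a := by
    ext b
    exact ⟨fun ⟨g, hg, h⟩ => ⟨⟨g, hg⟩, h⟩, fun ⟨g, h⟩ => ⟨g, g.2, h⟩⟩
  rw [Subgroup.relIndex, hstab, MulAction.index_stabilizer, horb]
  refine ⟨Set.finite_of_ncard_ne_zero, fun h => ?_⟩
  exact ((Set.ncard_pos h).2 (MulAction.nonempty_orbit a)).ne'

theorem ptStab_anti {A B : Set M} (h : A ⊆ B) : ptStab L B ≤ ptStab L A :=
  fun _ hg a ha => hg a (h ha)

theorem ptStab_eq_iInf (A : Set M) : ptStab L A = ⨅ a : A, ptStab L {(a : M)} := by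
  ext g
  simp only [Subgroup.mem_iInf]
  refine ⟨fun hg a b hb => ?_, fun hg a ha => hg ⟨a, ha⟩ a rfl⟩
  rw [Set.mem_singleton_iff.1 hb]
  exact hg a a.2

theorem relIndex_ptStab_ne_zero {A : Set M} (hA : A.Finite) {H : Subgroup (M ≃[L] M)}
    (h : ∀ a ∈ A, (orbit H a).Finite) : (ptStab L A).relIndex H ≠ 0 := by
  have := hA.to_subtype
  rw [ptStab_eq_iInf]
  exact Subgroup.relIndex_iInf_ne_zero fun a =>
    (relIndex_ptStab_singleton_ne_zero_iff H a).2 (h a a.2)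

theorem mem_acl_of_relIndex_ptStab_ne_zero {A B : Set M}
    (h : (ptStab L A).relIndex (ptStab L B) ≠ 0) : A ⊆ acl L B := fun a ha =>
  (relIndex_ptStab_singleton_ne_zero_iff _ a).1 fun h0 => h <|
    Subgroup.relIndex_eq_zero_of_le_left (ptStab_anti (Set.singleton_subset_iff.2 ha)) h0

theorem acl_acl_subset {B : Set M} (hB : (acl L B).Finite) : acl L (acl L B) ⊆ acl L B :=
  fun a ha => (relIndex_ptStab_singleton_ne_zero_iff _ a).1 <|
    Subgroup.relIndex_ne_zero_trans ((relIndex_ptStab_singleton_ne_zero_iff _ a).2 ha)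
      (relIndex_ptStab_ne_zero hB fun _ hb => hb)

theorem stabIn_bot (S : L.Substructure M) : stabIn S ⊥ = ptStab L (S : Set M) := by
  ext f
  constructor
  · rintro ⟨e, he, h⟩ a ha
    rw [Subgroup.mem_bot.1 he] at h
    exact h ⟨a, ha⟩
  · exact fun h => ⟨1, Subgroup.one_mem _, fun x => h x x.2⟩

theorem ptStab_le_stabIn (S : L.Substructure M) (L' : Subgroup (↥S ≃[L] ↥S)) :
    ptStab L (S : Set M) ≤ stabIn S L' :=
  fun _ h => ⟨1, L'.one_mem, fun x => h x x.2⟩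

theorem apply_mem_of_mem_stabIn {S : L.Substructure M} {L' : Subgroup (↥S ≃[L] ↥S)}
    {f : M ≃[L] M} (hf : f ∈ stabIn S L') {a : M} (ha : a ∈ S) : f a ∈ S := by
  obtain ⟨e, -, h⟩ := hf
  rw [h ⟨a, ha⟩]
  exact (e ⟨a, ha⟩).2

theorem relIndex_ptStab_stabIn_ne_zero {S : L.Substructure M} (hS : (S : Set M).Finite)
    (L' : Subgroup (↥S ≃[L] ↥S)) : (ptStab L (S : Set M)).relIndex (stabIn S L') ≠ 0 := by
  refine relIndex_ptStab_ne_zero hS fun a ha => hS.subset ?_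
  rintro _ ⟨g, hg, rfl⟩
  exact apply_mem_of_mem_stabIn hg ha

theorem normal_ptStab_subgroupOf_stabIn (S : L.Substructure M)
    (L' : Subgroup (↥S ≃[L] ↥S)) :
    ((ptStab L (S : Set M)).subgroupOf (stabIn S L')).Normal := by
  refine ⟨fun n hn g a ha => ?_⟩
  have hga : (g : M ≃[L] M)⁻¹ a ∈ S := apply_mem_of_mem_stabIn (inv_mem g.2) ha
  change (g : M ≃[L] M) ((n : M ≃[L] M) ((g : M ≃[L] M)⁻¹ a)) = a
  rw [show (n : M ≃[L] M) ((g : M ≃[L] M)⁻¹ a) = (g : M ≃[L] M)⁻¹ a from hn _ hga]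
  exact (g : M ≃[L] M).apply_symm_apply a

/-- `𝒫𝒮(M)` is exactly the set of `H ∈ 𝒮𝒮(M)` admitting no proper normal
subgroup of finite index belonging to `𝒮𝒮(M)`. -/
theorem statement_7 {L : FirstOrder.Language} {M : Type*} [L.Structure M]
    [Countable M] [Countable L.Symbols]
    (hhom : L.IsUltrahomogeneous M) (hssip : HasSSIP L M) (hlf : LocFinAlg L M) :
    PS L M = {H | H ∈ SS L M ∧
      ¬ ∃ H' ∈ SS L M, H' < H ∧ (H'.subgroupOf H).Normal ∧ (H'.subgroupOf H).FiniteIndex} := by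
  have hfin : ∀ S : L.Substructure M, memA L S → (S : Set M).Finite := by
    rintro S ⟨B, hB, h⟩
    exact h ▸ hlf B hB
  ext H
  constructor
  · rintro ⟨S, hS, rfl⟩
    refine ⟨⟨S, ⊥, hS, (stabIn_bot S).symm⟩, ?_⟩
    rintro ⟨_, ⟨T, L', hT, rfl⟩, hlt, -, hindex⟩
    have hsub : (T : Set M) ⊆ acl L (S : Set M) :=
      mem_acl_of_relIndex_ptStab_ne_zero <|
        Subgroup.relIndex_ne_zero_trans (relIndex_ptStab_stabIn_ne_zero (hfin T hT) L')
          hindex.index_ne_zero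
    obtain ⟨B, hB, hSB⟩ := hS
    rw [hSB] at hsub
    have hTS : (T : Set M) ⊆ S := hSB ▸ hsub.trans (acl_acl_subset (hlf B hB))
    exact hlt.not_ge ((ptStab_anti hTS).trans (ptStab_le_stabIn T L'))
  · rintro ⟨⟨S, L', hS, rfl⟩, hmin⟩
    refine ⟨S, hS, by_contra fun hne => hmin ?_⟩
    exact ⟨ptStab L (S : Set M), ⟨S, ⊥, hS, (stabIn_bot S).symm⟩,
      (ptStab_le_stabIn S L').lt_of_ne (Ne.symm hne),
      normal_ptStab_subgroupOf_stabIn S L',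
      ⟨relIndex_ptStab_stabIn_ne_zero (hfin S hS) L'⟩⟩

end PaperSSIP
end

section
/- Let M be a countable homogeneous structure with the strong small index property and locally finite algebraicity, G = Aut(M), and L a finite group. Then every abstract group automorphism F of G maps the family {G_(K) : K ∈ A(M) and Aut(K) ≅ L} onto itself: for K ∈ A(M) with Aut(K) ≅ L, F(G_(K)) = G_(K') for some K' ∈ A(M) with Aut(K') ≅ L. -/
open FirstOrder Cardinal

namespace PaperSSIP

variable {L : FirstOrder.Language} {M : Type*} [L.Structure M]

theorem injective_comp_out {G Y : Type*} [Group G] {K : Subgroup G} {f : G → Y}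
    (h : ∀ a b, f a = f b → a⁻¹ * b ∈ K) : Function.Injective fun q : G ⧸ K => f q.out :=
  fun p q hpq => by
    rw [← QuotientGroup.out_eq' p, ← QuotientGroup.out_eq' q]
    exact QuotientGroup.eq.mpr (h _ _ hpq)

theorem inv_mul_mem_ptStab {A : Set M} {g h : M ≃[L] M} (hgh : ∀ a ∈ A, g a = h a) :
    g⁻¹ * h ∈ ptStab L A := fun a ha => by
  rw [mul_apply, ← hgh a ha, ← mul_apply, inv_mul_cancel, one_apply]

theorem finite_quotient_ptStab_subgroupOf {A : Set M} (hA : A.Finite) (H : Subgroup (M ≃[L] M))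
    (h : ∀ a ∈ A, (orbit H a).Finite) : Finite (H ⧸ (ptStab L A).subgroupOf H) := by
  have : Finite A := hA
  have (a : A) : Finite (orbit H (a : M)) := h a a.2
  exact Finite.of_injective _ (injective_comp_out
    (f := fun (g : H) (a : A) => (⟨(g : M ≃[L] M) a, g, g.2, rfl⟩ : orbit H (a : M)))
    fun _ _ hab => inv_mul_mem_ptStab fun a ha =>
      congrArg Subtype.val (congrFun hab ⟨a, ha⟩))

theorem countable_quotient_ptStab [Countable M] {A : Set M} (hA : A.Finite) :
    Countable ((M ≃[L] M) ⧸ ptStab L A) := by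
  have : Finite A := hA
  exact (injective_comp_out (f := fun (g : M ≃[L] M) (a : A) => g (a : M))
    fun _ _ hab => inv_mul_mem_ptStab fun a ha => congrFun hab ⟨a, ha⟩).countable

theorem smallIndex_of_countable (H : Subgroup (M ≃[L] M)) [Countable ((M ≃[L] M) ⧸ H)] :
    SmallIndex H :=
  (mk_le_aleph0_iff.mpr inferInstance).trans_lt aleph0_lt_continuum

/-- A subgroup of finite relative index in a subgroup of countable index has countable index. -/
theorem countable_quotient_of_finite_subgroupOf {G : Type*} [Group G] {H₁ H : Subgroup G}
    (hle : H₁ ≤ H) [Countable (G ⧸ H)] [Finite (H ⧸ H₁.subgroupOf H)] : Countable (G ⧸ H₁) :=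
  (Subgroup.quotientEquivProdOfLE hle).injective.countable

theorem finite_orbit_of_finite_subgroupOf {H₁ H : Subgroup (M ≃[L] M)}
    [Finite (H ⧸ H₁.subgroupOf H)] {a : M} (h : (orbit H₁ a).Finite) : (orbit H a).Finite := by
  refine (Set.finite_iUnion fun q : H ⧸ H₁.subgroupOf H =>
    h.image (q.out : M ≃[L] M)).subset ?_
  rintro _ ⟨g, hg, rfl⟩
  set q : H ⧸ H₁.subgroupOf H := QuotientGroup.mk (⟨g, hg⟩ : H) with hq
  have hmem : (q.out)⁻¹ * ⟨g, hg⟩ ∈ H₁.subgroupOf H := by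
    rw [← QuotientGroup.eq, QuotientGroup.out_eq']
  refine Set.mem_iUnion.mpr ⟨q, _, ⟨_, Subgroup.mem_subgroupOf.mp hmem, rfl⟩, ?_⟩
  rw [← mul_apply]
  simp

theorem subset_acl (A : Set M) : A ⊆ acl L A := fun a ha =>
  (Set.finite_singleton a).subset (by rintro _ ⟨g, hg, rfl⟩; exact hg a ha)

theorem mem_of_fixed {A : Set M} (hA : acl L A ⊆ A) {a : M} (h : ∀ g ∈ ptStab L A, g a = a) :
    a ∈ A :=
  hA ((Set.finite_singleton a).subset (by rintro _ ⟨g, hg, rfl⟩; exact h g hg))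

theorem acl_acl_subset_s12 (hlf : LocFinAlg L M) {A : Set M} (hA : A.Finite) :
    acl L (acl L A) ⊆ acl L A := fun _ hb =>
  have := finite_quotient_ptStab_subgroupOf (hlf A hA) (ptStab L A) fun _ ha => ha
  finite_orbit_of_finite_subgroupOf (H₁ := ptStab L (acl L A)) hb

/-- The algebraic closure of a finite set, as a substructure. -/
def aclSubstructure (hlf : LocFinAlg L M) {A : Set M} (hA : A.Finite) : L.Substructure M where
  carrier := acl L A
  fun_mem f x hx := mem_of_fixed (acl_acl_subset_s12 hlf hA) fun g hg => by
    rw [g.map_fun]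
    congr 1
    exact funext fun i => hg _ (hx i)

theorem ptStab_le_of_finite_subgroupOf [Countable M] (hssip : HasSSIP L M) {K : Set M}
    (hK : K.Finite) (hacl : acl L K ⊆ K) {H : Subgroup (M ≃[L] M)} (hle : H ≤ ptStab L K)
    [Finite (ptStab L K ⧸ H.subgroupOf (ptStab L K))] : ptStab L K ≤ H := by
  have := countable_quotient_ptStab (L := L) hK
  have := countable_quotient_of_finite_subgroupOf hle
  obtain ⟨A, hA, hAH, hHA⟩ := hssip H (smallIndex_of_countable H)
  refine le_trans (ptStab_anti fun a ha => hacl ?_) hAH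
  refine finite_orbit_of_finite_subgroupOf (H₁ := H) (hA.subset ?_)
  rintro _ ⟨g, hg, rfl⟩
  have hgA : g '' A = A := hHA hg
  exact hgA ▸ Set.mem_image_of_mem g ha

theorem mem_normalizer_ptStab {K : Set M} (hacl : acl L K ⊆ K) {g : M ≃[L] M} :
    g ∈ Subgroup.normalizer (ptStab L K : Set (M ≃[L] M)) ↔ g ∈ setStab L K := by
  have maps {g : M ≃[L] M}
      (hg : g ∈ Subgroup.normalizer (ptStab L K : Set (M ≃[L] M))) {a : M} (ha : a ∈ K) :
      g a ∈ K := mem_of_fixed hacl fun h hh => by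
    have h1 := (Subgroup.mem_normalizer_iff.mp (inv_mem hg) h).mp hh a ha
    have h2 := congrArg g h1
    rw [inv_inv, mul_apply, mul_apply, ← mul_apply g, mul_inv_cancel, one_apply] at h2
    exact h2
  constructor
  · intro hg
    refine Set.Subset.antisymm (Set.image_subset_iff.mpr fun a ha => maps hg ha) fun a ha => ?_
    exact ⟨g⁻¹ a, maps (inv_mem hg) ha, by rw [← mul_apply, mul_inv_cancel, one_apply]⟩
  · have conj {g : M ≃[L] M} (hg : g ∈ setStab L K) {h : M ≃[L] M} (hh : h ∈ ptStab L K) :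
        g * h * g⁻¹ ∈ ptStab L K := fun a ha => by
      have hgi : (g⁻¹ : M ≃[L] M) '' K = K := inv_mem hg
      have : g⁻¹ a ∈ K := hgi ▸ Set.mem_image_of_mem _ ha
      rw [mul_apply, mul_apply, hh _ this, ← mul_apply, mul_inv_cancel, one_apply]
    intro hg
    refine Subgroup.mem_normalizer_iff.mpr fun h => ⟨conj hg, fun hh => ?_⟩
    have := conj (inv_mem hg) hh
    simpa [mul_assoc] using this

theorem apply_mem_of_mem_setStab {K : Set M} {g : M ≃[L] M} (hg : g ∈ setStab L K) {a : M}
    (ha : a ∈ K) : g a ∈ K := by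
  have h : g '' K = K := hg
  exact h ▸ Set.mem_image_of_mem g ha

/-- Restriction of the setwise stabilizer of a substructure to that substructure. -/
def restrictHom (S : L.Substructure M) : setStab L (S : Set M) →* (S ≃[L] S) where
  toFun g :=
    { toFun := fun x => ⟨(g : M ≃[L] M) x, apply_mem_of_mem_setStab g.2 x.2⟩
      invFun := fun x => ⟨(g⁻¹ : M ≃[L] M) x, apply_mem_of_mem_setStab (inv_mem g.2) x.2⟩
      left_inv := fun x => Subtype.ext ((g : M ≃[L] M).symm_apply_apply x)
      right_inv := fun x => Subtype.ext ((g : M ≃[L] M).apply_symm_apply x)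
      map_fun' := fun f x => Subtype.ext ((g : M ≃[L] M).map_fun f fun i => (x i : M))
      map_rel' := fun r x => (g : M ≃[L] M).map_rel r fun i => (x i : M) }
  map_one' := rfl
  map_mul' _ _ := rfl

theorem restrictHom_surjective (hhom : L.IsUltrahomogeneous M) {S : L.Substructure M}
    (hS : (S : Set M).Finite) : Function.Surjective (restrictHom S) := by
  intro e
  have hfg : S.FG := Language.Substructure.fg_def.mpr ⟨S, hS, S.closure_eq⟩
  obtain ⟨g, hg⟩ := hhom S hfg (S.subtype.comp e.toEmbedding)
  have hge (x : S) : g x = e x := (DFunLike.congr_fun hg x).symm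
  have hgS : g ∈ setStab L (S : Set M) := by
    refine Set.Subset.antisymm ?_ fun a ha => ?_
    · rintro _ ⟨a, ha, rfl⟩
      rw [hge ⟨a, ha⟩]
      exact (e _).2
    · exact ⟨e.symm ⟨a, ha⟩, (e.symm ⟨a, ha⟩).2, by rw [hge, e.apply_symm_apply]⟩
  exact ⟨⟨g, hgS⟩, FirstOrder.Language.Equiv.ext fun x => Subtype.ext (hge x)⟩

theorem mem_ker_restrictHom {S : L.Substructure M} {g : setStab L (S : Set M)} :
    g ∈ (restrictHom S).ker ↔ (g : M ≃[L] M) ∈ ptStab L (S : Set M) := by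
  rw [MonoidHom.mem_ker]
  constructor
  · intro h a ha
    exact congrArg Subtype.val (DFunLike.congr_fun h (⟨a, ha⟩ : S))
  · exact fun h => FirstOrder.Language.Equiv.ext fun x => Subtype.ext (h x x.2)

/-- An automorphism of the ambient group carrying the pointwise stabilizer of one finite
algebraically closed substructure to that of another makes their automorphism groups isomorphic. -/
theorem nonempty_mulEquiv_of_map_ptStab (hhom : L.IsUltrahomogeneous M) (F : MulAut (M ≃[L] M))
    {S S' : L.Substructure M} (hS : (S : Set M).Finite) (hS' : (S' : Set M).Finite)
    (hc : acl L (S : Set M) ⊆ S) (hc' : acl L (S' : Set M) ⊆ S')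
    (h : (ptStab L (S : Set M)).map F.toMonoidHom = ptStab L (S' : Set M)) :
    Nonempty ((S ≃[L] S) ≃* (S' ≃[L] S')) := by
  have hpt (g : M ≃[L] M) : F g ∈ ptStab L (S' : Set M) ↔ g ∈ ptStab L (S : Set M) := by
    rw [← h]
    exact Subgroup.mem_map_iff_mem (f := F.toMonoidHom) F.injective
  have hst : (setStab L (S : Set M)).map F.toMonoidHom = setStab L (S' : Set M) := by
    ext g
    obtain ⟨g, rfl⟩ := F.surjective g
    refine (Subgroup.mem_map_iff_mem (f := F.toMonoidHom) F.injective).trans ?_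
    rw [← mem_normalizer_ptStab hc, ← mem_normalizer_ptStab hc', Subgroup.mem_normalizer_iff,
      Subgroup.mem_normalizer_iff (g := F g)]
    refine Iff.trans ?_ F.surjective.forall.symm
    simp only [← map_inv, ← map_mul, hpt]
  let E : setStab L (S : Set M) ≃* setStab L (S' : Set M) :=
    (F.subgroupMap (setStab L (S : Set M))).trans (MulEquiv.subgroupCongr hst)
  let ψ := (restrictHom S').comp E.toMonoidHom
  have hψ : Function.Surjective ψ := (restrictHom_surjective hhom hS').comp E.surjective
  have hker : (restrictHom S).ker = ψ.ker := by
    ext g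
    rw [mem_ker_restrictHom, ← hpt, MonoidHom.mem_ker]
    exact mem_ker_restrictHom (g := E g).symm
  exact ⟨(QuotientGroup.quotientKerEquivOfSurjective _ (restrictHom_surjective hhom hS)).symm.trans
    ((QuotientGroup.quotientMulEquivOfEq hker).trans
      (QuotientGroup.quotientKerEquivOfSurjective ψ hψ))⟩

theorem finite_quotient_acl_subgroupOf (hlf : LocFinAlg L M) {A : Set M} (hA : A.Finite)
    {H : Subgroup (M ≃[L] M)} (hHA : H ≤ setStab L A) :
    Finite (H ⧸ (ptStab L (acl L A)).subgroupOf H) := by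
  have := finite_quotient_ptStab_subgroupOf hA H fun a ha =>
    hA.subset (by rintro _ ⟨g, hg, rfl⟩; exact apply_mem_of_mem_setStab (hHA hg) ha)
  exact finite_quotient_ptStab_subgroupOf (hlf A hA) H fun a ha =>
    finite_orbit_of_finite_subgroupOf (H₁ := ptStab L A) ha

/-- For a finite group `Λ`, every abstract group automorphism of `Aut(M)` maps
the family `{G_(K) : K ∈ 𝐀(M), Aut(K) ≅ Λ}` onto itself. -/
theorem statement_12 {L : FirstOrder.Language} {M : Type*} [L.Structure M]
    [Countable M] [Countable L.Symbols]
    (hhom : L.IsUltrahomogeneous M) (hssip : HasSSIP L M) (hlf : LocFinAlg L M)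
    (Λ : Type*) [Group Λ] [Finite Λ]
    (F : MulAut (M ≃[L] M))
    (S : L.Substructure M) (hS : memA L S) (hiso : Nonempty ((↥S ≃[L] ↥S) ≃* Λ)) :
    ∃ S' : L.Substructure M, memA L S' ∧ Nonempty ((↥S' ≃[L] ↥S') ≃* Λ) ∧
      (ptStab L (S : Set M)).map F.toMonoidHom = ptStab L (S' : Set M) := by
  obtain ⟨B, hB, hSB⟩ := hS
  have hSfin : (S : Set M).Finite := hSB ▸ hlf B hB
  have hSacl : acl L (S : Set M) ⊆ S := by
    rw [hSB]
    exact acl_acl_subset_s12 hlf hB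
  set H := (ptStab L (S : Set M)).map F.toMonoidHom with hH
  have := countable_quotient_ptStab (L := L) hSfin
  have : Countable ((M ≃[L] M) ⧸ H) := by
    refine Function.Surjective.countable
      (f := Quotient.map' (s₁ := QuotientGroup.leftRel (ptStab L (S : Set M)))
        (s₂ := QuotientGroup.leftRel H) F fun a b hab => ?_) ?_
    · rw [QuotientGroup.leftRel_apply] at hab ⊢
      rw [← map_inv, ← map_mul]
      exact Subgroup.mem_map_of_mem F.toMonoidHom hab
    · intro q
      obtain ⟨g, rfl⟩ := QuotientGroup.mk_surjective q
      obtain ⟨g, rfl⟩ := F.surjective g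
      exact ⟨(g : (M ≃[L] M) ⧸ ptStab L (S : Set M)), rfl⟩
  obtain ⟨A, hA, hAH, hHA⟩ := hssip H (smallIndex_of_countable H)
  have hfin := finite_quotient_acl_subgroupOf hlf hA hHA
  have hle : ptStab L (acl L A) ≤ H := (ptStab_anti (subset_acl A)).trans hAH
  have heq : H = ptStab L (acl L A) := by
    refine le_antisymm ?_ hle
    set P := (ptStab L (acl L A)).comap F.toMonoidHom with hP
    have hPle : P ≤ ptStab L (S : Set M) := fun g hg =>
      (Subgroup.mem_map_iff_mem (f := F.toMonoidHom) F.injective).mp (hle hg)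
    have : Finite (ptStab L (S : Set M) ⧸ P.subgroupOf (ptStab L (S : Set M))) := by
      have hidx : (ptStab L (acl L A)).relIndex H ≠ 0 :=
        Subgroup.index_ne_zero_of_finite
      rw [hH, ← Subgroup.relIndex_comap] at hidx
      have : (P.subgroupOf (ptStab L (S : Set M))).FiniteIndex := ⟨hidx⟩
      exact Subgroup.finite_quotient_of_finiteIndex
    exact Subgroup.map_le_iff_le_comap.mpr (ptStab_le_of_finite_subgroupOf hssip hSfin hSacl hPle)
  obtain ⟨e⟩ := nonempty_mulEquiv_of_map_ptStab hhom F (S' := aclSubstructure hlf hA) hSfin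
    (hlf A hA) hSacl (acl_acl_subset_s12 hlf hA) heq
  obtain ⟨i⟩ := hiso
  exact ⟨aclSubstructure hlf hA, ⟨A, hA, rfl⟩, ⟨e.symm.trans i⟩, heq⟩

end PaperSSIP
end
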